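/- arXiv:2510.22325 — 9 statements merged into one kernel-verified Lean document; each statement's English description precedes it below -/
import Mathlib

section
/- Let n ≥ 0 be an integer, let w = (w_0, …, w_n) be a vector of positive integers, and let x = (x_0, …, x_n) ∈ ℤ^{n+1} \ {0}. Then there exists a unique positive integer δ such that for every positive integer d one has: (d^{w_i} divides x_i for all 0 ≤ i ≤ n) if and only if d divides δ. -/
/-- If the `k`-th powers of all elements of `s` divide `a`, so does the `k`-th power of their
least common multiple. -/
theorem Finset.lcm_id_pow_dvd {s : Finset ℕ} {k a : ℕ} (h : ∀ d ∈ s, d ^ k ∣ a) :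
    s.lcm id ^ k ∣ a := by
  induction s using Finset.induction_on with
  | empty => simp
  | insert b s _ ih =>
    rw [Finset.lcm_insert, id, lcm_eq_nat_lcm, ← Nat.pow_lcm_pow]
    exact Nat.lcm_dvd (h b (Finset.mem_insert_self b s))
      (ih fun d hd => h d (Finset.mem_insert_of_mem hd))

/-- For a weight vector `w` of positive integers and `x ∈ ℤ^{n+1} \ {0}`, there exists a
unique positive integer `δ` such that for every positive integer `d`,
`d^{w i} ∣ x i` for all `i` iff `d ∣ δ`. -/
theorem stmt0 (n : ℕ) (w : Fin (n + 1) → ℕ) (hw : ∀ i, 0 < w i)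
    (x : Fin (n + 1) → ℤ) (hx : x ≠ 0) :
    ∃! δ : ℕ, 0 < δ ∧ ∀ d : ℕ, 0 < d →
      ((∀ i, (d : ℤ) ^ (w i) ∣ x i) ↔ d ∣ δ) := by
  have cast_iff (d : ℕ) (i) : (d : ℤ) ^ w i ∣ x i ↔ d ^ w i ∣ (x i).natAbs := by
    rw [← Int.natCast_pow, Int.natCast_dvd]
  simp only [cast_iff]
  obtain ⟨j, hj⟩ := Function.ne_iff.mp hx
  have hj' : (x j).natAbs ≠ 0 := Int.natAbs_ne_zero.mpr hj
  let s := {d ∈ (x j).natAbs.divisors | ∀ i, d ^ w i ∣ (x i).natAbs}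
  have hs (d : ℕ) : d ∈ s ↔ ∀ i, d ^ w i ∣ (x i).natAbs := by
    simp only [s, Finset.mem_filter, Nat.mem_divisors, and_iff_right_iff_imp]
    exact fun h => ⟨(dvd_pow_self d (hw j).ne').trans (h j), hj'⟩
  have hlcm (i) : s.lcm id ^ w i ∣ (x i).natAbs :=
    Finset.lcm_id_pow_dvd fun d hd => (hs d).mp hd i
  have hpos : 0 < s.lcm id :=
    Nat.pos_of_mem_divisors (Finset.mem_filter.mp ((hs _).mpr hlcm)).1
  refine ⟨s.lcm id, ⟨hpos, fun d _ => ⟨fun h => Finset.dvd_lcm (f := id) ((hs d).mpr h),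
    fun h i => (pow_dvd_pow_of_dvd h _).trans (hlcm i)⟩⟩, ?_⟩
  rintro δ ⟨hδ, h⟩
  exact Nat.dvd_antisymm (Finset.dvd_lcm (f := id) ((hs δ).mpr ((h δ hδ).mpr dvd_rfl)))
    ((h _ hpos).mp hlcm)
end

section
/- Let n ≥ 0 be an integer, let w = (w_0, …, w_n) be a vector of positive integers, let x ∈ ℤ^{n+1} \ {0}, and let d be a positive integer. Then gcd_w((d^{w_0} x_0, …, d^{w_n} x_n)) = d · gcd_w(x). -/
/-- `gcd_w((d^{w_0} x_0, …, d^{w_n} x_n)) = d · gcd_w(x)`, where `gcd_w` is characterized as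
the unique positive integer `δ` such that `(∀ i, e^{w i} ∣ ·) ↔ e ∣ δ` for all positive `e`. -/
theorem stmt2 (n : ℕ) (w : Fin (n + 1) → ℕ) (hw : ∀ i, 0 < w i)
    (x : Fin (n + 1) → ℤ) (hx : x ≠ 0) (d : ℕ) (hd : 0 < d)
    (δ₁ : ℕ) (hδ₁pos : 0 < δ₁)
    (hδ₁ : ∀ e : ℕ, 0 < e → ((∀ i, (e : ℤ) ^ (w i) ∣ x i) ↔ e ∣ δ₁))
    (δ₂ : ℕ) (hδ₂pos : 0 < δ₂)
    (hδ₂ : ∀ e : ℕ, 0 < e →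
      ((∀ i, (e : ℤ) ^ (w i) ∣ (d : ℤ) ^ (w i) * x i) ↔ e ∣ δ₂)) :
    δ₂ = d * δ₁ := by
  apply Nat.dvd_antisymm
  · obtain ⟨k, rfl⟩ : d ∣ δ₂ := (hδ₂ d hd).1 fun i => dvd_mul_right _ _
    have hk : 0 < k := Nat.pos_of_mul_pos_left hδ₂pos
    refine mul_dvd_mul_left d ((hδ₁ k hk).1 fun i => ?_)
    have h := (hδ₂ (d * k) hδ₂pos).2 dvd_rfl i
    rw [Nat.cast_mul, mul_pow] at h
    exact (mul_dvd_mul_iff_left (by positivity)).1 h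
  · refine (hδ₂ (d * δ₁) (Nat.mul_pos hd hδ₁pos)).1 fun i => ?_
    rw [Nat.cast_mul, mul_pow]
    exact mul_dvd_mul_left _ ((hδ₁ δ₁ hδ₁pos).2 dvd_rfl i)
end

section
/- Let n ≥ 0 be an integer and let w = (w_0, …, w_n) be a vector of positive integers. For every y ∈ ℚ^{n+1} \ {0} there exists λ ∈ ℚ^× such that the tuple (λ^{w_0} y_0, …, λ^{w_n} y_n) lies in ℤ^{n+1} and satisfies gcd_w((λ^{w_0} y_0, …, λ^{w_n} y_n)) = 1. Moreover, if λ' ∈ ℚ^× is another such element, then λ' = λ or λ' = −λ. -/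
/-- A nonzero integral tuple can be divided by a weighted scalar so that it becomes
weighted-primitive. -/
theorem exists_weightedPrimitive_of_ne_zero {ι : Type*} (w : ι → ℕ) (hw : ∀ i, 0 < w i)
    (x : ι → ℤ) (hx : x ≠ 0) :
    ∃ (m : ℕ) (z : ι → ℤ), 0 < m ∧ (∀ i, x i = (m : ℤ) ^ w i * z i) ∧
      ∀ d : ℕ, 0 < d → ((∀ i, (d : ℤ) ^ w i ∣ z i) ↔ d ∣ 1) := by
  classical
  obtain ⟨j, hj⟩ := Function.ne_iff.mp hx
  have hj' : 0 < (x j).natAbs := Int.natAbs_pos.mpr hj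
  have le_of_dvd (d : ℕ) (h : ∀ i, (d : ℤ) ^ w i ∣ x i) : d ≤ (x j).natAbs := by
    have h1 : (d : ℤ) ∣ x j := (dvd_pow_self _ (hw j).ne').trans (h j)
    exact Nat.le_of_dvd hj' (Int.natCast_dvd.mp h1)
  let P : ℕ → Prop := fun d => ∀ i, (d : ℤ) ^ w i ∣ x i
  let m := Nat.findGreatest P (x j).natAbs
  have hP1 : P 1 := fun i => by simp
  have hPm : P m := Nat.findGreatest_spec (P := P) hj' hP1
  have hm : 0 < m := Nat.le_findGreatest hj' hP1
  choose z hz using hPm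
  refine ⟨m, z, hm, hz, fun d hd => ⟨fun h => ?_, fun h i => ?_⟩⟩
  · have hPmd : P (m * d) := fun i => by
      rw [hz i, Nat.cast_mul, mul_pow]
      exact mul_dvd_mul_left _ (h i)
    have hle : m * d ≤ m * 1 := by
      rw [mul_one]
      exact Nat.le_findGreatest (le_of_dvd _ hPmd) hPmd
    have := Nat.le_of_mul_le_mul_left hle hm
    exact Nat.dvd_one.mpr (by omega)
  · simp [Nat.dvd_one.mp h]

/-- A rational number whose weighted action carries one weighted-primitive integral tuple
to another is `1` or `-1`. -/
theorem eq_one_or_neg_one_of_weightedPrimitive {ι : Type*} (w : ι → ℕ) (x x' : ι → ℤ) (q : ℚ)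
    (hq : q ≠ 0) (hxx' : ∀ i, (x' i : ℚ) = q ^ w i * x i)
    (hx : ∀ d : ℕ, 0 < d → (∀ i, (d : ℤ) ^ w i ∣ x i) → d ∣ 1)
    (hx' : ∀ d : ℕ, 0 < d → (∀ i, (d : ℤ) ^ w i ∣ x' i) → d ∣ 1) :
    q = 1 ∨ q = -1 := by
  have key (i : ι) : (q.den : ℤ) ^ w i * x' i = q.num ^ w i * x i := by
    have hden : (q.den : ℚ) ≠ 0 := by exact_mod_cast q.den_nz
    have h := hxx' i
    rw [← Rat.num_div_den q, div_pow] at h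
    field_simp at h
    rw [mul_comm] at h
    exact_mod_cast h
  have hcop : IsCoprime q.num (q.den : ℤ) := Rat.isCoprime_num_den q
  have hden : q.den = 1 := Nat.dvd_one.mp <| hx _ q.den_pos fun i =>
    (hcop.symm.pow (m := w i) (n := w i)).dvd_of_dvd_mul_left ⟨x' i, (key i).symm⟩
  have hnum : q.num.natAbs = 1 := Nat.dvd_one.mp <|
    hx' _ (Int.natAbs_pos.mpr (Rat.num_ne_zero.mpr hq)) fun i => by
      have h : q.num ^ w i ∣ x' i :=
        (hcop.pow (m := w i) (n := w i)).dvd_of_dvd_mul_left ⟨x i, key i⟩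
      rw [← Int.natAbs_dvd_natAbs] at h ⊢
      simpa only [Int.natAbs_pow, Int.natAbs_natCast] using h
  rw [← Rat.num_div_den q, hden]
  rcases Int.natAbs_eq q.num with h | h <;> rw [h, hnum] <;> simp

/-- A finite tuple of rationals becomes integral after a weighted scaling by a positive integer,
provided the weights are positive. -/
theorem exists_weighted_integral_multiple {ι : Type*} [Fintype ι] (w : ι → ℕ)
    (hw : ∀ i, 0 < w i) (y : ι → ℚ) :
    ∃ (D : ℕ) (x : ι → ℤ), 0 < D ∧ ∀ i, (x i : ℚ) = (D : ℚ) ^ w i * y i := by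
  have h (i : ι) : ∃ x : ℤ, (x : ℚ) = ((∏ k, (y k).den : ℕ) : ℚ) ^ w i * y i := by
    obtain ⟨c, hc⟩ : (y i).den ∣ (∏ k, (y k).den) ^ w i :=
      (Finset.dvd_prod_of_mem (fun k => (y k).den) (Finset.mem_univ i)).trans
        (dvd_pow_self _ (hw i).ne')
    refine ⟨c * (y i).num, ?_⟩
    rw [← Nat.cast_pow, hc]
    push_cast
    rw [← Rat.mul_den_eq_num (y i)]
    ring
  choose x hx using h
  exact ⟨_, x, Finset.prod_pos fun k _ => (y k).den_pos, hx⟩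


/-- Every `y ∈ ℚ^{n+1} \ {0}` admits `λ ∈ ℚ^×` such that `(λ^{w_i} y_i)_i` is an integral
tuple with weighted gcd equal to `1`, and such a `λ` is unique up to sign. -/
theorem stmt3 (n : ℕ) (w : Fin (n + 1) → ℕ) (hw : ∀ i, 0 < w i)
    (y : Fin (n + 1) → ℚ) (hy : y ≠ 0) :
    ∃ l : ℚ, l ≠ 0 ∧
      (∃ x : Fin (n + 1) → ℤ, (∀ i, (x i : ℚ) = l ^ (w i) * y i) ∧
        (∀ d : ℕ, 0 < d → ((∀ i, (d : ℤ) ^ (w i) ∣ x i) ↔ d ∣ 1))) ∧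
      (∀ l' : ℚ, l' ≠ 0 →
        (∃ x : Fin (n + 1) → ℤ, (∀ i, (x i : ℚ) = l' ^ (w i) * y i) ∧
          (∀ d : ℕ, 0 < d → ((∀ i, (d : ℤ) ^ (w i) ∣ x i) ↔ d ∣ 1))) →
        l' = l ∨ l' = -l) := by
  obtain ⟨D, x, hD, hx⟩ := exists_weighted_integral_multiple w hw y
  have hDQ : (D : ℚ) ≠ 0 := by exact_mod_cast hD.ne'
  have hx0 : x ≠ 0 := by
    rintro rfl
    refine hy (funext fun i => ?_)
    simpa [hDQ] using (hx i).symm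
  obtain ⟨m, z, hm, hz, hprim⟩ := exists_weightedPrimitive_of_ne_zero w hw x hx0
  have hmQ : (m : ℚ) ≠ 0 := by exact_mod_cast hm.ne'
  have hl : (D / m : ℚ) ≠ 0 := div_ne_zero hDQ hmQ
  have hzy (i) : (z i : ℚ) = (D / m : ℚ) ^ w i * y i := by
    have h := hx i
    rw [hz i] at h
    push_cast at h
    rw [div_pow, div_mul_eq_mul_div, eq_div_iff (pow_ne_zero _ hmQ), ← h, mul_comm]
  refine ⟨D / m, hl, ⟨z, hzy, hprim⟩, ?_⟩
  rintro l' hl' ⟨x', hx', hprim'⟩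
  have hxx' (i) : (x' i : ℚ) = (l' / (D / m : ℚ)) ^ w i * z i := by
    rw [hx', hzy, ← mul_assoc, ← mul_pow, div_mul_cancel₀ _ hl]
  have h := eq_one_or_neg_one_of_weightedPrimitive w z x' _ (div_ne_zero hl' hl) hxx'
    (fun d hd => (hprim d hd).mp) (fun d hd => (hprim' d hd).mp)
  rwa [div_eq_iff hl, div_eq_iff hl, one_mul, neg_one_mul] at h
end

section
/- Let n ≥ 0 be an integer, let w = (w_0, …, w_n) be a vector of positive integers, and let T = { t ∈ ℚ : 0 < t < 1 and w_i · t ∈ ℤ for some 0 ≤ i ≤ n } (a finite set). Let y ∈ ℤ^{n+1} \ {0} with gcd_w(y) = 1, and let (k_t)_{t ∈ T} be a family of positive integers. Then the following are equivalent: (1) for every t ∈ T, k_t is the product of all primes p such that the fractional part of min_{i : y_i ≠ 0} v_p(y_i)/w_i equals t; (2) the integers k_t (t ∈ T) are squarefree and pairwise coprime, and there exists y' = (y'_0, …, y'_n) ∈ ℤ^{n+1} \ {0} such that (a) gcd(y'_0, …, y'_n) = 1, (b) for every 0 ≤ j ≤ n, y_j = ( ∏_{t ∈ T} k_t^{⌈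 w_j t ⌉} ) · y'_j, and (c) for every t ∈ T, gcd( k_t , { y'_j : 0 ≤ j ≤ n and w_j t ∈ ℤ } ) = 1. -/
/-- Membership in the finite set
`T = { t ∈ ℚ : 0 < t < 1 and w_i · t ∈ ℤ for some i }`
(`(q : ℚ).den = 1` encodes `q ∈ ℤ`). -/
def Tcond {n : ℕ} (w : Fin (n + 1) → ℕ) (t : ℚ) : Prop :=
  0 < t ∧ t < 1 ∧ ∃ i, ((w i : ℚ) * t).den = 1

/-- `min_{i : y i ≠ 0} v_p(y_i) / w_i`, the minimum being taken in `ℚ` over the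
(nonempty) set of indices `i` with `y i ≠ 0`. -/
noncomputable def minVal {n : ℕ} (w : Fin (n + 1) → ℕ) (y : Fin (n + 1) → ℤ)
    (hy : y ≠ 0) (p : ℕ) : ℚ :=
  ((Finset.univ.filter fun i => y i ≠ 0).image
      fun i => (padicValInt p (y i) : ℚ) / (w i : ℚ)).min'
    (by
      obtain ⟨i, hi⟩ := Function.ne_iff.mp hy
      exact ⟨_, Finset.mem_image.mpr ⟨i, Finset.mem_filter.mpr ⟨Finset.mem_univ i, hi⟩, rfl⟩⟩)

section

variable {n : ℕ} {w : Fin (n + 1) → ℕ} {y : Fin (n + 1) → ℤ}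

theorem finite_setOf_Tcond (hw : ∀ i, 0 < w i) : {t | Tcond w t}.Finite := by
  refine (Set.finite_iUnion fun i : Fin (n + 1) =>
    (Finset.range (w i)).finite_toSet.image fun a : ℕ => (a : ℚ) / w i).subset ?_
  rintro t ⟨h0, h1, i, hi⟩
  have hwi : (0 : ℚ) < w i := by exact_mod_cast hw i
  rw [Rat.den_eq_one_iff] at hi
  have hnum : 0 < ((w i : ℚ) * t).num := Rat.num_pos.mpr (by positivity)
  have hcast : ((((w i : ℚ) * t).num.toNat : ℕ) : ℚ) = w i * t := by
    rw [← Int.cast_natCast, Int.toNat_of_nonneg hnum.le, hi]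
  refine Set.mem_iUnion.mpr ⟨i, ((w i : ℚ) * t).num.toNat, ?_, ?_⟩
  · simp only [Finset.coe_range, Set.mem_Iio]
    have : ((((w i : ℚ) * t).num.toNat : ℕ) : ℚ) < w i := by rw [hcast]; nlinarith
    exact_mod_cast this
  · simp only [hcast]
    field_simp

theorem le_minVal_iff (hw : ∀ i, 0 < w i) (hy : y ≠ 0) {p : ℕ} (hp : p.Prime) {t : ℚ} :
    t ≤ minVal w y hy p ↔ ∀ j, (p : ℤ) ^ ⌈(w j : ℚ) * t⌉.toNat ∣ y j := by
  have := Fact.mk hp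
  simp only [minVal, Finset.le_min'_iff, Finset.forall_mem_image, Finset.mem_filter,
    Finset.mem_univ, true_and, padicValInt_dvd_iff, or_iff_not_imp_left]
  refine forall_congr' fun i => imp_congr_right fun _ => ?_
  have hwi : (0 : ℚ) < w i := by exact_mod_cast hw i
  rw [le_div_iff₀ hwi, Int.toNat_le, Int.ceil_le, mul_comm t, Int.cast_natCast]

theorem exists_minVal_eq (hy : y ≠ 0) (p : ℕ) :
    ∃ i, y i ≠ 0 ∧ minVal w y hy p = (padicValInt p (y i) : ℚ) / w i := by
  obtain ⟨i, hi, h⟩ := Finset.mem_image.mp (Finset.min'_mem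
    ((Finset.univ.filter fun i => y i ≠ 0).image
      fun i => (padicValInt p (y i) : ℚ) / (w i : ℚ)) (by
    obtain ⟨i, hi⟩ := Function.ne_iff.mp hy
    exact ⟨_, Finset.mem_image.mpr ⟨i, Finset.mem_filter.mpr ⟨Finset.mem_univ i, hi⟩, rfl⟩⟩))
  exact ⟨i, (Finset.mem_filter.mp hi).2, h.symm⟩

theorem minVal_nonneg (hy : y ≠ 0) (p : ℕ) : 0 ≤ minVal w y hy p := by
  obtain ⟨i, -, h⟩ := exists_minVal_eq (w := w) hy p
  rw [h]
  positivity

theorem minVal_le (hy : y ≠ 0) (p : ℕ) {i : Fin (n + 1)} (hi : y i ≠ 0) :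
    minVal w y hy p ≤ (padicValInt p (y i) : ℚ) / w i :=
  Finset.min'_le _ _ (Finset.mem_image.mpr ⟨i, by simpa using hi, rfl⟩)

theorem minVal_eq_iff (hw : ∀ i, 0 < w i) (hy : y ≠ 0) {p : ℕ} (hp : p.Prime) {t : ℚ}
    (ht : 0 ≤ t) :
    minVal w y hy p = t ↔ (∀ j, (p : ℤ) ^ ⌈(w j : ℚ) * t⌉.toNat ∣ y j) ∧
      ∃ i, ((w i : ℚ) * t).den = 1 ∧ ¬ (p : ℤ) ^ (⌈(w i : ℚ) * t⌉.toNat + 1) ∣ y i := by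
  have := Fact.mk hp
  constructor
  · rintro rfl
    refine ⟨(le_minVal_iff hw hy hp).mp le_rfl, ?_⟩
    obtain ⟨i, hi, h⟩ := exists_minVal_eq (w := w) hy p
    have hwi : (w i : ℚ) ≠ 0 := by exact_mod_cast (hw i).ne'
    have hv : (w i : ℚ) * minVal w y hy p = (padicValInt p (y i) : ℕ) := by
      rw [h]; field_simp
    refine ⟨i, by rw [hv]; simp, ?_⟩
    rw [padicValInt_dvd_iff, hv]
    simp [hi]
  · rintro ⟨hdvd, i, hi, hnot⟩
    refine le_antisymm ?_ ((le_minVal_iff hw hy hp).mpr hdvd)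
    rw [padicValInt_dvd_iff, not_or, not_le, Nat.lt_succ_iff] at hnot
    refine (minVal_le hy p hnot.1).trans ?_
    have hwi : (0 : ℚ) < w i := by exact_mod_cast hw i
    rw [div_le_iff₀ hwi, mul_comm t]
    have hceil : ((⌈(w i : ℚ) * t⌉.toNat : ℕ) : ℚ) = w i * t := by
      rw [Rat.den_eq_one_iff] at hi
      rw [← Int.cast_natCast, Int.toNat_of_nonneg (Int.ceil_nonneg (by positivity)), ← hi,
        Int.ceil_intCast]
    rw [← hceil]
    exact_mod_cast hnot.2

theorem minVal_lt_one (hw : ∀ i, 0 < w i) (hy : y ≠ 0)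
    (hprim : ∀ d : ℕ, 0 < d → ((∀ i, (d : ℤ) ^ (w i) ∣ y i) ↔ d ∣ 1)) {p : ℕ} (hp : p.Prime) :
    minVal w y hy p < 1 := by
  by_contra! h
  refine hp.one_lt.ne' (Nat.dvd_one.mp ((hprim p hp.pos).mp fun i => ?_))
  simpa using (le_minVal_iff hw hy hp).mp h i

theorem fract_minVal (hw : ∀ i, 0 < w i) (hy : y ≠ 0)
    (hprim : ∀ d : ℕ, 0 < d → ((∀ i, (d : ℤ) ^ (w i) ∣ y i) ↔ d ∣ 1)) {p : ℕ} (hp : p.Prime) :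
    Int.fract (minVal w y hy p) = minVal w y hy p :=
  Int.fract_eq_self.mpr ⟨minVal_nonneg hy p, minVal_lt_one hw hy hprim hp⟩

theorem Tcond_minVal (hw : ∀ i, 0 < w i) (hy : y ≠ 0)
    (hprim : ∀ d : ℕ, 0 < d → ((∀ i, (d : ℤ) ^ (w i) ∣ y i) ↔ d ∣ 1)) {p : ℕ} (hp : p.Prime)
    (hpos : 0 < minVal w y hy p) : Tcond w (minVal w y hy p) := by
  obtain ⟨-, i, hi, -⟩ := (minVal_eq_iff hw hy hp hpos.le).mp rfl
  exact ⟨hpos, minVal_lt_one hw hy hprim hp, i, hi⟩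

theorem finite_setOf_minVal_eq (hw : ∀ i, 0 < w i) (hy : y ≠ 0) {t : ℚ} (ht : 0 < t) :
    {p : ℕ | p.Prime ∧ minVal w y hy p = t}.Finite := by
  obtain ⟨i, hi⟩ := Function.ne_iff.mp hy
  refine (y i).natAbs.primeFactors.finite_toSet.subset ?_
  rintro p ⟨hp, rfl⟩
  refine Nat.mem_primeFactors.mpr ⟨hp, ?_, Int.natAbs_ne_zero.mpr hi⟩
  have hwi : (0 : ℚ) < w i := by exact_mod_cast hw i
  refine Int.natCast_dvd.mp ((dvd_pow_self _ ?_).trans ((le_minVal_iff hw hy hp).mp le_rfl i))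
  have := Int.ceil_pos.mpr (mul_pos hwi ht)
  omega

theorem Nat.eq_prod_iff_squarefree_and_dvd_iff {s : Finset ℕ} (hs : ∀ p ∈ s, p.Prime) {m : ℕ} :
    m = ∏ p ∈ s, p ↔ Squarefree m ∧ ∀ p, p.Prime → (p ∣ m ↔ p ∈ s) := by
  constructor
  · rintro rfl
    refine ⟨Finset.squarefree_prod_of_pairwise_isCoprime (fun p hp q hq hpq => ?_)
      fun p hp => (hs p hp).prime.squarefree, fun p hp => ?_⟩
    · exact Nat.coprime_iff_isRelPrime.mp ((Nat.coprime_primes (hs p hp) (hs q hq)).mpr hpq)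
    · conv_rhs => rw [← Nat.primeFactors_prod hs]
      have : ∏ p ∈ s, p ≠ 0 := Finset.prod_ne_zero_iff.mpr fun p hp => (hs p hp).ne_zero
      simp [Nat.mem_primeFactors, hp, this]
  · rintro ⟨hsq, h⟩
    rw [← Nat.prod_primeFactors_of_squarefree hsq]
    congr 1
    ext p
    rw [Nat.mem_primeFactors]
    exact ⟨fun hp => (h p hp.1).mp hp.2.1,
      fun hp => ⟨hs p hp, (h p (hs p hp)).mpr hp, hsq.ne_zero⟩⟩

theorem eq_finprod_fract_minVal_iff (hw : ∀ i, 0 < w i) (hy : y ≠ 0)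
    (hprim : ∀ d : ℕ, 0 < d → ((∀ i, (d : ℤ) ^ (w i) ∣ y i) ↔ d ∣ 1)) {t : ℚ} (ht : 0 < t)
    {m : ℕ} :
    m = ∏ᶠ (p : ℕ) (_ : p.Prime ∧ Int.fract (minVal w y hy p) = t), p ↔
      Squarefree m ∧ ∀ p, p.Prime → (p ∣ m ↔ minVal w y hy p = t) := by
  have hset : {p : ℕ | p.Prime ∧ Int.fract (minVal w y hy p) = t} =
      {p : ℕ | p.Prime ∧ minVal w y hy p = t} := by
    ext p
    exact and_congr_right fun hp => by rw [fract_minVal hw hy hprim hp]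
  have hfin : {p : ℕ | p.Prime ∧ Int.fract (minVal w y hy p) = t}.Finite :=
    hset ▸ finite_setOf_minVal_eq hw hy ht
  have hprod : ∏ᶠ (p : ℕ) (_ : p.Prime ∧ Int.fract (minVal w y hy p) = t), p =
      ∏ p ∈ hfin.toFinset, p := finprod_mem_eq_finite_toFinset_prod _ hfin
  rw [hprod, Nat.eq_prod_iff_squarefree_and_dvd_iff fun p hp => by simp_all]
  refine and_congr_right fun _ => forall₂_congr fun p hp => ?_
  simp [hp, fract_minVal hw hy hprim hp]

theorem Squarefree.natCast_pow_dvd {m : ℕ} (hm : Squarefree m) {c : ℕ} {z : ℤ}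
    (h : ∀ p, p.Prime → p ∣ m → (p : ℤ) ^ c ∣ z) : (m : ℤ) ^ c ∣ z := by
  rw [← Nat.prod_primeFactors_of_squarefree hm, Nat.cast_prod, ← Finset.prod_pow]
  refine Finset.prod_dvd_of_coprime (fun p hp q hq hpq => ?_) fun p hp =>
    h p (Nat.prime_of_mem_primeFactors hp) (Nat.dvd_of_mem_primeFactors hp)
  exact ((Nat.coprime_primes (Nat.prime_of_mem_primeFactors hp)
    (Nat.prime_of_mem_primeFactors hq)).mpr hpq).isCoprime.pow

theorem Finset.exists_not_dvd_of_not_dvd_gcd {ι : Type*} {s : Finset ι} {f : ι → ℤ} {a : ℤ}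
    (h : ¬ a ∣ s.gcd f) : ∃ i ∈ s, ¬ a ∣ f i := by
  rw [Finset.dvd_gcd_iff] at h
  push Not at h
  exact h

/-- A prime dividing exactly one of the squarefree, pairwise coprime `k t` divides
`∏ t, k t ^ c t` to the exact order `c t`. -/
theorem not_pow_succ_dvd_prod_mul {S : Finset ℚ} {k : ℚ → ℕ} {c : ℚ → ℕ} {p : ℕ} (hp : p.Prime)
    {t : ℚ} (htS : t ∈ S) (hsq : Squarefree (k t)) (hpt : p ∣ k t)
    (hne : ∀ t' ∈ S, t' ≠ t → ¬ p ∣ k t') {z : ℤ} (hz : ¬ (p : ℤ) ∣ z) :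
    ¬ (p : ℤ) ^ (c t + 1) ∣ (∏ t ∈ S, (k t : ℤ) ^ c t) * z := by
  have hpZ : Prime (p : ℤ) := Nat.prime_iff_prime_int.mp hp
  obtain ⟨m, hm⟩ := hpt
  have hpm : ¬ (p : ℤ) ∣ m := fun h => hp.not_isUnit <| hsq p <| by
    rw [hm]
    exact mul_dvd_mul_left p (Int.natCast_dvd_natCast.mp h)
  intro h
  rw [← Finset.mul_prod_erase S _ htS, hm, Nat.cast_mul, mul_pow, pow_succ, mul_assoc, mul_assoc,
    mul_dvd_mul_iff_left (pow_ne_zero _ hpZ.ne_zero)] at h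
  rcases hpZ.dvd_or_dvd h with h | h
  · exact hpm (hpZ.dvd_of_dvd_pow h)
  rcases hpZ.dvd_or_dvd h with h | h
  · obtain ⟨t', ht', h⟩ := (hpZ.dvd_finsetProd_iff _).mp h
    rw [Finset.mem_erase] at ht'
    exact hne t' ht'.2 ht'.1 (Int.natCast_dvd_natCast.mp (hpZ.dvd_of_dvd_pow h))
  · exact hz h

end

/-- Description of the integral points of the extended universal torsor of the weighted
projective stack `P(w)`: for `y` weighted-primitive, the family `(k_t)_{t ∈ T}` records the
sector heights iff it is a family of pairwise coprime squarefree integers allowing a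
factorization `y_j = (∏_t k_t^{⌈w_j t⌉}) y'_j` with `y'` primitive and the extra gcd condition. -/
theorem stmt4 (n : ℕ) (w : Fin (n + 1) → ℕ) (hw : ∀ i, 0 < w i)
    (y : Fin (n + 1) → ℤ) (hy : y ≠ 0)
    (hprim : ∀ d : ℕ, 0 < d → ((∀ i, (d : ℤ) ^ (w i) ∣ y i) ↔ d ∣ 1))
    (k : ℚ → ℕ) (hk : ∀ t, Tcond w t → 0 < k t) :
    (∀ t, Tcond w t →
        k t = ∏ᶠ (p : ℕ) (_ : p.Prime ∧ Int.fract (minVal w y hy p) = t), p)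
      ↔
    ((∀ t, Tcond w t → Squarefree (k t)) ∧
      (∀ t t', Tcond w t → Tcond w t' → t ≠ t' → Nat.Coprime (k t) (k t')) ∧
      ∃ y' : Fin (n + 1) → ℤ, y' ≠ 0 ∧
        Finset.univ.gcd y' = 1 ∧
        (∀ j, y j = (∏ᶠ (t : ℚ) (_ : Tcond w t),
            (k t : ℤ) ^ (⌈(w j : ℚ) * t⌉.toNat)) * y' j) ∧
        (∀ t, Tcond w t →
          Int.gcd (k t : ℤ)
            ((Finset.univ.filter fun j => ((w j : ℚ) * t).den = 1).gcd y') = 1)) := by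
  have hT := finite_setOf_Tcond hw
  have hprod : ∀ j, (∏ᶠ (t : ℚ) (_ : Tcond w t), (k t : ℤ) ^ (⌈(w j : ℚ) * t⌉.toNat)) =
      ∏ t ∈ hT.toFinset, (k t : ℤ) ^ (⌈(w j : ℚ) * t⌉.toNat) := fun j =>
    finprod_mem_eq_finite_toFinset_prod _ hT
  have hmem : ∀ t, t ∈ hT.toFinset ↔ Tcond w t := by simp
  simp only [hprod]
  rw [forall₂_congr fun t (ht : Tcond w t) => eq_finprod_fract_minVal_iff hw hy hprim ht.1]
  constructor
  · intro h
    have hcop : ∀ t t', Tcond w t → Tcond w t' → t ≠ t' → Nat.Coprime (k t) (k t') :=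
      fun t t' ht ht' hne => Nat.coprime_of_dvd fun p hp hpt hpt' =>
        hne ((((h t ht).2 p hp).mp hpt).symm.trans (((h t' ht').2 p hp).mp hpt'))
    have hdvd : ∀ j, ∏ t ∈ hT.toFinset, (k t : ℤ) ^ (⌈(w j : ℚ) * t⌉.toNat) ∣ y j := by
      refine fun j => Finset.prod_dvd_of_coprime (fun t ht t' ht' hne => ?_) fun t ht => ?_
      · exact (hcop t t' ((hmem t).mp ht) ((hmem t').mp ht') hne).isCoprime.pow
      · have ht := (hmem t).mp ht
        exact (h t ht).1.natCast_pow_dvd fun p hp hpt =>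
          (le_minVal_iff hw hy hp).mp (((h t ht).2 p hp).mp hpt).ge j
    choose y' hy' using hdvd
    have hwit : ∀ p, p.Prime →
        ∃ i, ((w i : ℚ) * minVal w y hy p).den = 1 ∧ ¬ (p : ℤ) ∣ y' i := by
      intro p hp
      obtain ⟨-, i, hi, hnot⟩ := (minVal_eq_iff hw hy hp (minVal_nonneg hy p)).mp rfl
      refine ⟨i, hi, fun hpy => hnot ?_⟩
      rw [hy' i, pow_succ]
      refine mul_dvd_mul ?_ hpy
      rcases (minVal_nonneg hy p).eq_or_lt with h0 | hpos
      · rw [← h0]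
        simp
      have hTp := Tcond_minVal hw hy hprim hp hpos
      refine dvd_trans (pow_dvd_pow_of_dvd ?_ _)
        (Finset.dvd_prod_of_mem _ ((hmem _).mpr hTp))
      exact Int.natCast_dvd_natCast.mpr (((h _ hTp).2 p hp).mpr rfl)
    refine ⟨fun t ht => (h t ht).1, hcop, y', ?_, ?_, hy', fun t ht => ?_⟩
    · rintro rfl
      exact hy (funext fun j => by simpa using hy' j)
    · rw [← Finset.normalize_gcd, ← Int.abs_eq_normalize, Int.abs_eq_natAbs, Nat.cast_eq_one,
        Nat.eq_one_iff_not_exists_prime_dvd]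
      intro p hp hdvd
      obtain ⟨i, -, hi⟩ := hwit p hp
      exact hi ((Int.natCast_dvd.mpr hdvd).trans (Finset.gcd_dvd (Finset.mem_univ i)))
    · rw [Nat.eq_one_iff_not_exists_prime_dvd]
      intro p hp hdvd
      have hdvd := Int.natCast_dvd_natCast.mpr hdvd
      obtain ⟨i, hi, hnot⟩ := hwit p hp
      rw [((h t ht).2 p hp).mp
        (Int.natCast_dvd_natCast.mp (hdvd.trans (Int.gcd_dvd_left _ _)))] at hi
      exact hnot ((hdvd.trans (Int.gcd_dvd_right _ _)).trans
        (Finset.gcd_dvd (Finset.mem_filter.mpr ⟨Finset.mem_univ i, hi⟩)))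
  · rintro ⟨hsq, hcop, y', -, hgcd, hy', hgcdk⟩
    have hval : ∀ t, Tcond w t → ∀ p, p.Prime → p ∣ k t → minVal w y hy p = t := by
      intro t ht p hp hpt
      refine (minVal_eq_iff hw hy hp ht.1.le).mpr ⟨fun j => ?_, ?_⟩
      · rw [hy' j]
        exact ((pow_dvd_pow_of_dvd (Int.natCast_dvd_natCast.mpr hpt) _).trans
          (Finset.dvd_prod_of_mem (fun t => (k t : ℤ) ^ ⌈(w j : ℚ) * t⌉.toNat)
            ((hmem t).mpr ht))).mul_right _
      · obtain ⟨i, hi, hnot⟩ := Finset.exists_not_dvd_of_not_dvd_gcd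
          (fun h => hp.not_dvd_one <| hgcdk t ht ▸ Int.natCast_dvd_natCast.mp
            (Int.dvd_coe_gcd (Int.natCast_dvd_natCast.mpr hpt) h))
        refine ⟨i, (Finset.mem_filter.mp hi).2, ?_⟩
        rw [hy' i]
        refine not_pow_succ_dvd_prod_mul (c := fun t => ⌈(w i : ℚ) * t⌉.toNat) hp
          ((hmem t).mpr ht) (hsq t ht) hpt (fun t' ht' hne hpt' => ?_) hnot
        exact Nat.not_coprime_of_dvd_of_dvd hp.one_lt hpt' hpt
          (hcop t' t ((hmem t').mp ht') ht hne)
    refine fun t ht => ⟨hsq t ht, fun p hp => ⟨hval t ht p hp, fun hm => ?_⟩⟩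
    by_contra hpt
    have hnone : ∀ t', Tcond w t' → ¬ p ∣ k t' := fun t' ht' hpt' =>
      hpt ((hval t' ht' p hp hpt').symm.trans hm ▸ hpt')
    have hpZ : Prime (p : ℤ) := Nat.prime_iff_prime_int.mp hp
    obtain ⟨i, -, hi⟩ := Finset.exists_not_dvd_of_not_dvd_gcd (a := (p : ℤ))
      (fun h => hpZ.not_dvd_one (hgcd ▸ h))
    have hm0 : minVal w y hy p = 0 := by
      refine (minVal_eq_iff hw hy hp le_rfl).mpr ⟨by simp, i, by simp, fun hdvd => ?_⟩
      simp only [mul_zero, Int.ceil_zero, Int.toNat_zero, zero_add, pow_one] at hdvd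
      rw [hy' i] at hdvd
      refine (hpZ.dvd_or_dvd hdvd).elim (fun hdvd => ?_) hi
      obtain ⟨t', ht', hdvd⟩ := (hpZ.dvd_finsetProd_iff _).mp hdvd
      exact hnone t' ((hmem t').mp ht')
        (Int.natCast_dvd_natCast.mp (hpZ.dvd_of_dvd_pow hdvd))
    exact ht.1.ne (hm0.symm.trans hm)
end

section
/- Let S be a nonempty finite set and let Λ_1, …, Λ_m ∈ ℕ^S be finitely many vectors such that each Λ_i has coordinate sum |Λ_i| ≥ 2 and every coordinate Λ_{i,ρ} ≤ 2. Let μ_loc : ℕ^S → ℤ be the associated local Möbius function. Then for every λ ∈ ℕ^S having some coordinate λ_ρ ≥ 3, one has μ_loc(λ) = 0. -/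
/-- The local Möbius function `μloc` vanishes on every `λ` having a coordinate `≥ 3`. -/
theorem stmt7 (S : Type*) [Fintype S] [DecidableEq S] [Nonempty S]
    (m : ℕ) (Λ : Fin m → S → ℕ)
    (hsum : ∀ i, 2 ≤ ∑ ρ, Λ i ρ) (hle : ∀ i ρ, Λ i ρ ≤ 2)
    (μloc : (S → ℕ) → ℤ)
    (hμ : ∀ τ : S → ℕ,
      (if ∀ i, ∃ ρ, τ ρ < Λ i ρ then (1 : ℤ) else 0) = ∑ l ∈ Finset.Iic τ, μloc l) :
    ∀ l : S → ℕ, (∃ ρ, 3 ≤ l ρ) → μloc l = 0 := by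
  intro l
  induction l using WellFoundedLT.induction with
  | _ l ih =>
    rintro ⟨r, hr⟩
    set l' : S → ℕ := Function.update l r (l r - 1) with hl'
    have hl'l : l' ≤ l := by
      intro ρ
      by_cases h : ρ = r
      · subst h; simp [hl']
      · simp [hl', h]
    have hind : (∀ i, ∃ ρ, l' ρ < Λ i ρ) ↔ ∀ i, ∃ ρ, l ρ < Λ i ρ := by
      refine forall_congr' fun i => exists_congr fun ρ => ?_
      by_cases h : ρ = r
      · subst h
        have := hle i ρ
        simp only [hl', Function.update_self]
        omega
      · simp [hl', h]
    have heq : ∑ k ∈ Finset.Iic l', μloc k = ∑ k ∈ Finset.Iic l, μloc k := by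
      rw [← hμ, ← hμ]
      simp only [hind]
    have hsdiff := Finset.sum_sdiff (f := μloc) (Finset.Iic_subset_Iic.2 hl'l)
    have hsingle : ∑ k ∈ Finset.Iic l \ Finset.Iic l', μloc k = μloc l := by
      refine Finset.sum_eq_single l (fun k hk hkl => ?_) (fun hl => ?_)
      · simp only [Finset.mem_sdiff, Finset.mem_Iic] at hk
        refine ih k (lt_of_le_of_ne hk.1 hkl) ⟨r, ?_⟩
        by_contra! hkr
        refine hk.2 fun ρ => ?_
        by_cases h : ρ = r
        · subst h
          simp only [hl', Function.update_self]
          omega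
        · simpa [hl', h] using hk.1 ρ
      · refine absurd ?_ hl
        simp only [Finset.mem_sdiff, Finset.mem_Iic, le_refl, true_and]
        intro h
        have := h r
        simp only [hl', Function.update_self] at this
        omega
    linarith
end

section
/- Let S be a nonempty finite set and let Λ_1, …, Λ_m ∈ ℕ^S be finitely many vectors such that each Λ_i has coordinate sum |Λ_i| ≥ 2 and every coordinate Λ_{i,ρ} ≤ 2. Let μ_loc : ℕ^S → ℤ be the associated local Möbius function. Then for every λ ∈ ℕ^S with |λ| ≥ 3 · #S, one has μ_loc(λ) = 0. -/
/-- A function vanishes at every point whose `ρ`-coordinate exceeds `N`, if its partial sums over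
lower sets do not change when a `ρ`-coordinate that exceeds `N` is lowered by one. -/
theorem eq_zero_of_sum_Iic_update_pred {S A : Type*} [Fintype S] [DecidableEq S] [AddCommGroup A]
    (f : (S → ℕ) → A) (ρ : S) (N : ℕ)
    (hf : ∀ τ : S → ℕ, N < τ ρ →
      ∑ l ∈ Finset.Iic τ, f l = ∑ l ∈ Finset.Iic (Function.update τ ρ (τ ρ - 1)), f l)
    (τ : S → ℕ) (hτ : N < τ ρ) : f τ = 0 := by
  induction τ using WellFoundedLT.induction with
  | ind τ ih =>
    have hsub : Finset.Iic (Function.update τ ρ (τ ρ - 1)) ⊆ Finset.Iic τ :=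
      Finset.Iic_subset_Iic.2 (update_le_self_iff.2 (Nat.sub_le _ _))
    have hsplit := Finset.sum_sdiff (f := f) hsub
    rw [hf τ hτ, add_eq_right] at hsplit
    rw [← hsplit]
    symm
    apply Finset.sum_eq_single_of_mem
    · simp only [Finset.mem_sdiff, Finset.mem_Iic, le_refl, true_and, le_update_iff]
      omega
    · intro l hl hne
      simp only [Finset.mem_sdiff, Finset.mem_Iic, le_update_iff, not_and] at hl
      have hρ : ¬ l ρ ≤ τ ρ - 1 := fun h => hl.2 h fun i _ => hl.1 i
      exact ih l (lt_of_le_of_ne hl.1 hne) (by omega)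


/-- The local Möbius function `μloc` vanishes on every `λ` with `|λ| ≥ 3 · #S`. -/
theorem stmt8 (S : Type*) [Fintype S] [DecidableEq S] [Nonempty S]
    (m : ℕ) (Λ : Fin m → S → ℕ)
    (hsum : ∀ i, 2 ≤ ∑ ρ, Λ i ρ) (hle : ∀ i ρ, Λ i ρ ≤ 2)
    (μloc : (S → ℕ) → ℤ)
    (hμ : ∀ τ : S → ℕ,
      (if ∀ i, ∃ ρ, τ ρ < Λ i ρ then (1 : ℤ) else 0) = ∑ l ∈ Finset.Iic τ, μloc l) :
    ∀ l : S → ℕ, 3 * Fintype.card S ≤ ∑ ρ, l ρ → μloc l = 0 := by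
  intro l hl
  obtain ⟨ρ, hρ⟩ : ∃ ρ, 2 < l ρ := by
    obtain ⟨ρ, -, hρ⟩ := Finset.exists_le_of_sum_le (s := Finset.univ) (f := fun _ : S => 3)
      (g := l) Finset.univ_nonempty (by simpa [mul_comm] using hl)
    exact ⟨ρ, hρ⟩
  refine eq_zero_of_sum_Iic_update_pred μloc ρ 2 (fun τ hτ => ?_) l hρ
  rw [← hμ, ← hμ]
  refine if_congr (forall_congr' fun i => exists_congr fun σ => ?_) rfl rfl
  rcases eq_or_ne σ ρ with rfl | hσ
  · have := hle i σ
    simp only [Function.update_self]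
    omega
  · rw [Function.update_of_ne hσ]
end

section
/- Let S be a nonempty finite set and let Λ_1, …, Λ_m ∈ ℕ^S be finitely many vectors such that each Λ_i has coordinate sum |Λ_i| ≥ 2 and every coordinate Λ_{i,ρ} ≤ 2. Let μ_loc : ℕ^S → ℤ be the associated local Möbius function. Then there exists a polynomial Q with nonnegative integer coefficients, depending only on S and the Λ_i (not on p or s), such that for every prime p and every real number s: Σ_{λ ∈ ℕ^S} |μ_loc(λ)| · p^{−s·|λ|} = 1 + p^{−2s} · Q(p^{−s}), where the sum on the left has only finitely many nonzero terms. -/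
section LocalMoebius

variable {S : Type*} [Fintype S] [DecidableEq S] {m : ℕ} {Λ : Fin m → S → ℕ} {μloc : (S → ℕ) → ℤ}

/-- A local Möbius function vanishes at every vector one of whose coordinates exceeds the bound
`b` on the coordinates of the `Λ i`. -/
theorem localMoebius_eq_zero_of_lt {b : ℕ} (hle : ∀ i ρ, Λ i ρ ≤ b)
    (hμ : ∀ τ : S → ℕ,
      (if ∀ i, ∃ ρ, τ ρ < Λ i ρ then (1 : ℤ) else 0) = ∑ l ∈ Finset.Iic τ, μloc l)
    (ρ : S) (l : S → ℕ) (hl : b < l ρ) : μloc l = 0 := by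
  induction l using WellFoundedLT.induction with
  | ind l ih =>
    have hupd : Function.update l ρ (l ρ - 1) ≤ l :=
      update_le_self_iff.2 (Nat.sub_le _ _)
    have hX : (∀ i, ∃ σ, Function.update l ρ (l ρ - 1) σ < Λ i σ) ↔ ∀ i, ∃ σ, l σ < Λ i σ := by
      refine forall_congr' fun i => exists_congr fun σ => ?_
      rcases eq_or_ne σ ρ with rfl | h
      · have := hle i σ
        simp only [Function.update_self]
        omega
      · simp [h]
    have hsub := Finset.sum_sdiff (f := μloc) (Finset.Iic_subset_Iic.2 hupd)
    have hsum : ∑ k ∈ Finset.Iic (Function.update l ρ (l ρ - 1)), μloc k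
        = ∑ k ∈ Finset.Iic l, μloc k := by
      rw [← hμ, ← hμ]
      simp only [hX]
    have hsingle : ∑ k ∈ Finset.Iic l \ Finset.Iic (Function.update l ρ (l ρ - 1)), μloc k
        = μloc l := by
      refine Finset.sum_eq_single l (fun k hk hne => ?_) (fun h => ?_)
      · simp only [Finset.mem_sdiff, Finset.mem_Iic, le_update_iff, not_and_or] at hk
        refine ih k (lt_of_le_of_ne hk.1 hne) ?_
        rcases hk.2 with h | h
        · omega
        · exact absurd (fun j _ => hk.1 j) h
      · refine absurd ?_ h
        simp only [Finset.mem_sdiff, Finset.mem_Iic, le_refl, true_and, le_update_iff, not_and_or]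
        left
        omega
    linarith

theorem sum_localMoebius_eq_one (hsum : ∀ i, 2 ≤ ∑ ρ, Λ i ρ)
    (hμ : ∀ τ : S → ℕ,
      (if ∀ i, ∃ ρ, τ ρ < Λ i ρ then (1 : ℤ) else 0) = ∑ l ∈ Finset.Iic τ, μloc l)
    {τ : S → ℕ} (hτ : ∑ ρ, τ ρ < 2) : ∑ l ∈ Finset.Iic τ, μloc l = 1 := by
  rw [← hμ, if_pos]
  intro i
  by_contra! h
  have := Finset.sum_le_sum fun ρ (_ : ρ ∈ Finset.univ) => h ρ
  have := hsum i
  omega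

theorem localMoebius_zero (hsum : ∀ i, 2 ≤ ∑ ρ, Λ i ρ)
    (hμ : ∀ τ : S → ℕ,
      (if ∀ i, ∃ ρ, τ ρ < Λ i ρ then (1 : ℤ) else 0) = ∑ l ∈ Finset.Iic τ, μloc l) :
    μloc 0 = 1 := by
  rw [← sum_localMoebius_eq_one hsum hμ (τ := 0) (by simp), Finset.sum_eq_single 0]
  · intro k hk hne
    exact absurd (le_antisymm (Finset.mem_Iic.1 hk) fun _ => Nat.zero_le _) hne
  · simp

theorem localMoebius_eq_zero_of_sum_eq_one (hsum : ∀ i, 2 ≤ ∑ ρ, Λ i ρ)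
    (hμ : ∀ τ : S → ℕ,
      (if ∀ i, ∃ ρ, τ ρ < Λ i ρ then (1 : ℤ) else 0) = ∑ l ∈ Finset.Iic τ, μloc l)
    {l : S → ℕ} (hl : ∑ ρ, l ρ = 1) : μloc l = 0 := by
  have hne : l ≠ 0 := by
    rintro rfl
    simp at hl
  have hsingle : ∑ k ∈ (Finset.Iic l).erase l, μloc k = μloc 0 := by
    refine Finset.sum_eq_single 0 (fun k hk hk0 => ?_) (fun h => ?_)
    · rw [Finset.mem_erase, Finset.mem_Iic] at hk
      obtain ⟨-, ρ, hρ⟩ := Pi.lt_def.1 (lt_of_le_of_ne hk.2 hk.1)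
      have hlt : ∑ ρ, k ρ < ∑ ρ, l ρ :=
        Finset.sum_lt_sum (fun ρ _ => hk.2 ρ) ⟨ρ, Finset.mem_univ ρ, hρ⟩
      refine absurd (funext fun σ => ?_) hk0
      exact Finset.sum_eq_zero_iff.1 (by omega : ∑ ρ, k ρ = 0) σ (Finset.mem_univ σ)
    · exact absurd (Finset.mem_erase.2
        ⟨hne.symm, Finset.mem_Iic.2 fun _ => Nat.zero_le _⟩) h
  have h1 := sum_localMoebius_eq_one hsum hμ (τ := l) (by omega)
  rw [← Finset.add_sum_erase _ _ (Finset.mem_Iic.2 le_rfl), hsingle,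
    localMoebius_zero hsum hμ] at h1
  linarith

end LocalMoebius

/-- There is a polynomial `Q` with nonnegative integer coefficients, independent of `p`
and `s`, such that `Σ_λ |μloc(λ)| p^{-s|λ|} = 1 + p^{-2s} Q(p^{-s})`; the sum (a `finsum`)
has only finitely many nonzero terms since `μloc` has finite support. -/
theorem stmt9 (S : Type*) [Fintype S] [DecidableEq S] [Nonempty S]
    (m : ℕ) (Λ : Fin m → S → ℕ)
    (hsum : ∀ i, 2 ≤ ∑ ρ, Λ i ρ) (hle : ∀ i ρ, Λ i ρ ≤ 2)
    (μloc : (S → ℕ) → ℤ)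
    (hμ : ∀ τ : S → ℕ,
      (if ∀ i, ∃ ρ, τ ρ < Λ i ρ then (1 : ℤ) else 0) = ∑ l ∈ Finset.Iic τ, μloc l) :
    (Function.support μloc).Finite ∧
    ∃ Q : Polynomial ℕ, ∀ p : ℕ, p.Prime → ∀ s : ℝ,
      ∑ᶠ l : S → ℕ, (|μloc l| : ℝ) * (p : ℝ) ^ (-(s * ((∑ ρ, l ρ : ℕ) : ℝ)))
        = 1 + (p : ℝ) ^ (-(2 * s)) *
            Polynomial.eval₂ (Nat.castRingHom ℝ) ((p : ℝ) ^ (-s)) Q := by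
  have hfin : (Function.support μloc).Finite := by
    refine (Set.finite_Iic (fun _ : S => 2)).subset fun l hl ρ => ?_
    by_contra! h
    exact hl (localMoebius_eq_zero_of_lt hle hμ ρ l h)
  have hzero := localMoebius_zero hsum hμ
  refine ⟨hfin, ∑ l ∈ hfin.toFinset.erase 0,
    Polynomial.C (μloc l).natAbs * Polynomial.X ^ (∑ ρ, l ρ - 2), fun p hp s => ?_⟩
  have hp0 : (0 : ℝ) < p := by exact_mod_cast hp.pos
  rw [finsum_eq_sum_of_support_subset (s := hfin.toFinset),
    ← Finset.add_sum_erase _ _ (show 0 ∈ hfin.toFinset by simp [hzero])]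
  · congr 1
    · simp [hzero]
    · rw [Polynomial.eval₂_finsetSum, Finset.mul_sum]
      refine Finset.sum_congr rfl fun l hl => ?_
      rw [Finset.mem_erase, Set.Finite.mem_toFinset, Function.mem_support] at hl
      have hl2 : 2 ≤ ∑ ρ, l ρ := by
        by_contra! h
        have h1 : ∑ ρ, l ρ ≠ 1 := fun h1 => hl.2 (localMoebius_eq_zero_of_sum_eq_one hsum hμ h1)
        refine hl.1 (funext fun σ => ?_)
        exact Finset.sum_eq_zero_iff.1 (by omega : ∑ ρ, l ρ = 0) σ (Finset.mem_univ σ)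
      obtain ⟨n, hn⟩ := Nat.exists_eq_add_of_le hl2
      have hpow : (p : ℝ) ^ (-(s * ((2 + n : ℕ) : ℝ)))
          = (p : ℝ) ^ (-(2 * s)) * ((p : ℝ) ^ (-s)) ^ n := by
        rw [← Real.rpow_mul_natCast hp0.le, ← Real.rpow_add hp0]
        congr 1
        push_cast
        ring
      rw [hn, hpow, Polynomial.eval₂_mul, Polynomial.eval₂_C, Polynomial.eval₂_X_pow,
        Nat.add_sub_cancel_left, eq_natCast, Nat.cast_natAbs, Int.cast_abs]
      ring
  · intro l hl
    rw [Set.Finite.coe_toFinset]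
    intro h
    simp [h] at hl
end

section
/- Let S be a nonempty finite set and let Λ_1, …, Λ_m ∈ ℕ^S be finitely many vectors such that each Λ_i has coordinate sum |Λ_i| ≥ 2 and every coordinate Λ_{i,ρ} ≤ 2. Let μ_loc : ℕ^S → ℤ be the associated local Möbius function, and let p be a prime. Equip ℤ_p^S (the S-indexed product of copies of the ring of p-adic integers) with the product of the Haar probability measures on ℤ_p. Then the measure of the set { x ∈ ℤ_p^S : for every 1 ≤ i ≤ m there exists ρ ∈ S with v_p(x_ρ) < Λ_{i,ρ} } equals Σ_{λ ∈ ℕ^S} μ_loc(λ) · p^{−|λ|}, where v_p denotes the p-adic valuation on ℤ_p (with v_p(0) regarded as +∞, so a coordinate x_ρ = 0 never satisfies v_p(x_ρ) < Λ_{i,ρ}), and the sum has only finitely many nonzero terms. -/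
open MeasureTheory

/-- If the summatory function of `g` only depends on `τ ⊓ N`, then `g` vanishes outside `Iic N`. -/
theorem eq_zero_of_sum_Iic_inf_eq {S : Type*} [Fintype S] [DecidableEq S] {g h : (S → ℕ) → ℤ}
    (hg : ∀ τ, h τ = ∑ l ∈ Finset.Iic τ, g l) {N : S → ℕ} (hN : ∀ τ, h (τ ⊓ N) = h τ)
    (l : S → ℕ) (hl : ¬ l ≤ N) : g l = 0 := by
  induction l using WellFoundedLT.induction with
  | ind l ih =>
    have hnot : l ∉ Finset.Iic (l ⊓ N) := by simp [hl]
    have hsub : insert l (Finset.Iic (l ⊓ N)) ⊆ Finset.Iic l := by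
      intro x hx
      simp only [Finset.mem_insert, Finset.mem_Iic, le_inf_iff] at hx ⊢
      rcases hx with rfl | hx
      exacts [le_rfl, hx.1]
    have hsum : ∑ x ∈ insert l (Finset.Iic (l ⊓ N)), g x = ∑ x ∈ Finset.Iic l, g x := by
      refine Finset.sum_subset hsub fun x hx hx' => ?_
      simp only [Finset.mem_insert, Finset.mem_Iic, le_inf_iff, not_or, not_and] at hx hx'
      exact ih x (lt_of_le_of_ne hx hx'.1) (hx'.2 hx)
    rw [Finset.sum_insert hnot, ← hg, ← hg, hN] at hsum
    linarith

/-- The ideal `p ^ n ℤ_p` has Haar probability measure `p ^ (-n)`. -/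
theorem PadicInt.measureReal_span_pow {p : ℕ} [Fact p.Prime]
    [MeasurableSpace ℤ_[p]] [BorelSpace ℤ_[p]]
    (μ : Measure ℤ_[p]) [μ.IsAddHaarMeasure] [IsProbabilityMeasure μ] (n : ℕ) :
    MeasurableSet ((Ideal.span {(p : ℤ_[p]) ^ n} : Ideal ℤ_[p]) : Set ℤ_[p]) ∧
    μ.real ((Ideal.span {(p : ℤ_[p]) ^ n} : Ideal ℤ_[p]) : Set ℤ_[p])
      = (p : ℝ) ^ (-(n : ℤ)) := by
  have hmeas : MeasurableSet ((Ideal.span {(p : ℤ_[p]) ^ n} : Ideal ℤ_[p]) : Set ℤ_[p]) := by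
    have : ((Ideal.span {(p : ℤ_[p]) ^ n} : Ideal ℤ_[p]) : Set ℤ_[p])
        = {x | ‖x‖ ≤ (p : ℝ) ^ (-n : ℤ)} := by
      ext x
      exact (PadicInt.norm_le_pow_iff_mem_span_pow x n).symm
    rw [this]
    exact (isClosed_le continuous_norm continuous_const).measurableSet
  refine ⟨hmeas, ?_⟩
  have hp : p ≠ 0 := (Fact.out : p.Prime).ne_zero
  have : NeZero (p ^ n) := ⟨pow_ne_zero n hp⟩
  let H : AddSubgroup ℤ_[p] := (PadicInt.toZModPow (p := p) n).toAddMonoidHom.ker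
  have hH : (H : Set ℤ_[p]) = ((Ideal.span {(p : ℤ_[p]) ^ n} : Ideal ℤ_[p]) : Set ℤ_[p]) := by
    rw [← PadicInt.ker_toZModPow]
    rfl
  have hindex : H.index = p ^ n := by
    rw [AddSubgroup.index_ker, AddMonoidHom.range_eq_top.2
      (ZMod.ringHom_surjective (PadicInt.toZModPow (p := p) n))]
    simp
  have : H.FiniteIndex := ⟨by rw [hindex]; exact NeZero.ne _⟩
  have key := AddSubgroup.index_mul_measure H (hH ▸ hmeas) μ
  rw [hindex, hH, measure_univ] at key
  have key' := congrArg ENNReal.toReal key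
  rw [ENNReal.toReal_mul] at key'
  simp only [Nat.cast_pow, ENNReal.toReal_pow, ENNReal.toReal_natCast, ENNReal.toReal_one] at key'
  rw [zpow_neg, zpow_natCast, measureReal_def]
  exact eq_inv_of_mul_eq_one_right key'

/-- The box `∏ p ^ (l ρ) ℤ_p` has Haar probability measure `p ^ (-|l|)`. -/
theorem PadicInt.measureReal_pi_span_pow {S : Type*} [Fintype S] {p : ℕ} [Fact p.Prime]
    [MeasurableSpace ℤ_[p]] [BorelSpace ℤ_[p]]
    (μ : Measure ℤ_[p]) [μ.IsAddHaarMeasure] [IsProbabilityMeasure μ] (l : S → ℕ) :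
    (Measure.pi fun _ : S => μ).real (Set.univ.pi fun ρ =>
      ((Ideal.span {(p : ℤ_[p]) ^ l ρ} : Ideal ℤ_[p]) : Set ℤ_[p]))
      = (p : ℝ) ^ (-((∑ ρ, l ρ : ℕ) : ℤ)) := by
  rw [measureReal_def, Measure.pi_pi, ENNReal.toReal_prod]
  simp only [← measureReal_def, (PadicInt.measureReal_span_pow μ _).2, zpow_neg, zpow_natCast,
    Finset.prod_inv_distrib, Finset.prod_pow_eq_pow_sum]

/-- The Haar-probability measure of the local set of integral points of the extended
universal torsor, `{ x ∈ ℤ_p^S : ∀ i, ∃ ρ, v_p(x ρ) < Λ i ρ }` (a coordinate `x ρ = 0`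
never satisfies the condition), equals `Σ_λ μloc(λ) p^{-|λ|}`. -/
theorem stmt10 (S : Type*) [Fintype S] [DecidableEq S] [Nonempty S]
    (m : ℕ) (Λ : Fin m → S → ℕ)
    (hsum : ∀ i, 2 ≤ ∑ ρ, Λ i ρ) (hle : ∀ i ρ, Λ i ρ ≤ 2)
    (μloc : (S → ℕ) → ℤ)
    (hμ : ∀ τ : S → ℕ,
      (if ∀ i, ∃ ρ, τ ρ < Λ i ρ then (1 : ℤ) else 0) = ∑ l ∈ Finset.Iic τ, μloc l)
    (p : ℕ) [Fact p.Prime]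
    [MeasurableSpace ℤ_[p]] [BorelSpace ℤ_[p]]
    (μ : Measure ℤ_[p]) [μ.IsAddHaarMeasure] [IsProbabilityMeasure μ] :
    ((Measure.pi fun _ : S => μ)
        {x : S → ℤ_[p] | ∀ i, ∃ ρ, x ρ ≠ 0 ∧ (x ρ).valuation < (Λ i ρ : ℤ)}).toReal
      = ∑ᶠ l : S → ℕ, (μloc l : ℝ) * (p : ℝ) ^ (-((∑ ρ, l ρ : ℕ) : ℤ)) := by
  classical
  let N : S → ℕ := fun _ => 2
  have hzero : ∀ l, ¬ l ≤ N → μloc l = 0 := by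
    refine eq_zero_of_sum_Iic_inf_eq hμ fun τ => if_congr ?_ rfl rfl
    refine forall_congr' fun i => exists_congr fun ρ => ?_
    have := hle i ρ
    simp only [Pi.inf_apply, N]
    omega
  let B : (S → ℕ) → Set (S → ℤ_[p]) := fun l => Set.univ.pi fun ρ =>
    ((Ideal.span {(p : ℤ_[p]) ^ l ρ} : Ideal ℤ_[p]) : Set ℤ_[p])
  have hB : ∀ l, MeasurableSet (B l) := fun l =>
    MeasurableSet.univ_pi fun ρ => (PadicInt.measureReal_span_pow μ (l ρ)).1
  set A : Set (S → ℤ_[p]) :=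
    {x | ∀ i, ∃ ρ, x ρ ≠ 0 ∧ (x ρ).valuation < (Λ i ρ : ℤ)} with hA
  have hind : ∀ x, A.indicator (fun _ => (1 : ℝ)) x
      = ∑ l ∈ Finset.Iic N, (μloc l : ℝ) * (B l).indicator (fun _ => (1 : ℝ)) x := by
    intro x
    let τ : S → ℕ := fun ρ => if x ρ = 0 then 2 else min (x ρ).valuation 2
    have hxA : x ∈ A ↔ ∀ i, ∃ ρ, τ ρ < Λ i ρ := by
      refine forall_congr' fun i => exists_congr fun ρ => ?_
      have := hle i ρ
      by_cases h : x ρ = 0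
      · simp [τ, h, this]
      · simp only [τ, h, if_false, ne_eq, not_false_eq_true, true_and, Nat.cast_lt]
        omega
    have hxB : ∀ l ≤ N, (x ∈ B l ↔ l ≤ τ) := by
      intro l hl
      simp only [B, Set.mem_univ_pi, Pi.le_def, SetLike.mem_coe]
      refine forall_congr' fun ρ => ?_
      have : l ρ ≤ 2 := hl ρ
      by_cases h : x ρ = 0
      · simp [τ, h, this]
      · rw [PadicInt.mem_span_pow_iff_le_valuation _ h]
        simp only [τ, h, if_false]
        omega
    have hτ : τ ≤ N := by
      intro ρ
      simp only [τ, N]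
      split_ifs <;> omega
    have h1 : A.indicator (fun _ => (1 : ℝ)) x
        = ((if ∀ i, ∃ ρ, τ ρ < Λ i ρ then (1 : ℤ) else 0 : ℤ) : ℝ) := by
      by_cases h : x ∈ A
      · rw [Set.indicator_of_mem h, if_pos (hxA.1 h), Int.cast_one]
      · rw [Set.indicator_of_notMem h, if_neg (mt hxA.2 h), Int.cast_zero]
    rw [h1, hμ, Int.cast_sum, ← Finset.sum_subset (Finset.Iic_subset_Iic.2 hτ)]
    · refine Finset.sum_congr rfl fun l hl => ?_
      have hl := Finset.mem_Iic.1 hl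
      rw [Set.indicator_of_mem ((hxB l (hl.trans hτ)).2 hl), mul_one]
    · intro l hl hl'
      rw [Finset.mem_Iic] at hl hl'
      rw [Set.indicator_of_notMem (mt (hxB l hl).1 hl'), mul_zero]
  have hmeasA : MeasurableSet A := by
    rw [← measurable_indicator_const_iff (1 : ℝ)]
    rw [funext hind]
    exact Finset.measurable_sum _ fun l _ =>
      (measurable_const.indicator (hB l)).const_mul _
  rw [finsum_eq_sum_of_support_subset (s := Finset.Iic N)]
  · rw [← measureReal_def, ← integral_indicator_one hmeasA]
    change ∫ x, A.indicator (fun _ => (1 : ℝ)) x ∂_ = _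
    simp only [hind]
    rw [integral_finsetSum _ fun l _ =>
      (((integrable_const (1 : ℝ)).indicator (hB l)).const_mul _)]
    refine Finset.sum_congr rfl fun l _ => ?_
    rw [integral_const_mul, ← PadicInt.measureReal_pi_span_pow μ l,
      ← integral_indicator_one (hB l)]
    rfl
  · intro l hl
    by_contra h
    exact hl (by simp [hzero l (by simpa using h)])
end

section
/- Let S be a nonempty finite set and let Λ_1, …, Λ_m ∈ ℕ^S be finitely many vectors such that each Λ_i has coordinate sum |Λ_i| ≥ 2 and every coordinate Λ_{i,ρ} ≤ 2. Let μ be the associated global Möbius function and Π(d) = Π_{ρ∈S} d_ρ. Then for every ε ∈ (0, 1/2) there exists a constant C > 0 such that for every real Y > 1: Σ_{d ∈ (ℕ_{>0})^S, Π(d) ≤ Y} |μ(d)| ≤ C · Y^{1/2 + ε}. -/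
/-- The global Möbius function `μ(d) = Π_p μloc((v_p(d_ρ))_ρ)`, a product over all primes
with only finitely many factors different from `1`. -/
noncomputable def muGlob {S : Type*} (μloc : (S → ℕ) → ℤ) (d : S → ℕ) : ℤ :=
  ∏ᶠ (p : ℕ) (_ : p.Prime), μloc fun ρ => (d ρ).factorization p

/-- If `μ` has equal sums over the boxes below `σ` and `τ`, where `σ < τ`, and `μ`
vanishes strictly below `τ` outside the box below `σ`, then `μ` vanishes at `τ`. -/
theorem eq_zero_of_sum_Iic_eq {S : Type*} [Fintype S] [DecidableEq S]
    (μ : (S → ℕ) → ℤ) {σ τ : S → ℕ} (hlt : σ < τ)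
    (hsum : ∑ l ∈ Finset.Iic σ, μ l = ∑ l ∈ Finset.Iic τ, μ l)
    (hzero : ∀ l, l < τ → ¬ l ≤ σ → μ l = 0) : μ τ = 0 := by
  have hsub : insert τ (Finset.Iic σ) ⊆ Finset.Iic τ := by
    intro l hl
    rcases Finset.mem_insert.1 hl with rfl | hl
    · simp
    · exact Finset.mem_Iic.2 ((Finset.mem_Iic.1 hl).trans hlt.le)
  have h := Finset.sum_subset (f := μ) hsub (by
    intro l hl hl'
    simp only [Finset.mem_insert, Finset.mem_Iic, not_or] at hl hl'
    exact hzero l (lt_of_le_of_ne hl hl'.1) hl'.2)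
  rw [Finset.sum_insert (by simpa using hlt.not_ge), ← hsum] at h
  linarith

/-- The local Möbius function is `1` at the origin, vanishes on vectors of weight one and is
supported on vectors with all coordinates at most `2`. -/
theorem localMoebius_support {S : Type*} [Fintype S] [DecidableEq S]
    {m : ℕ} {Λ : Fin m → S → ℕ}
    (hsum : ∀ i, 2 ≤ ∑ ρ, Λ i ρ) (hle : ∀ i ρ, Λ i ρ ≤ 2)
    {μloc : (S → ℕ) → ℤ}
    (hμ : ∀ τ : S → ℕ,
      (if ∀ i, ∃ ρ, τ ρ < Λ i ρ then (1 : ℤ) else 0) = ∑ l ∈ Finset.Iic τ, μloc l) :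
    μloc 0 = 1 ∧ (∀ l, ∑ ρ, l ρ = 1 → μloc l = 0) ∧ ∀ l, μloc l ≠ 0 → ∀ ρ, l ρ ≤ 2 := by
  have hsmall : ∀ τ : S → ℕ, ∑ ρ, τ ρ < 2 → ∑ l ∈ Finset.Iic τ, μloc l = 1 := by
    intro τ hτ
    rw [← hμ, if_pos]
    intro i
    obtain ⟨ρ, -, h⟩ := Finset.exists_lt_of_sum_lt (hτ.trans_le (hsum i))
    exact ⟨ρ, h⟩
  refine ⟨?_, ?_, ?_⟩
  · have h := hsmall 0 (by simp)
    have h0 : Finset.Iic (0 : S → ℕ) = {0} := by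
      ext l; simp
    simpa [h0] using h
  · intro l hl
    have hpos : (0 : S → ℕ) < l := by
      refine lt_of_le_of_ne (fun _ => Nat.zero_le _) ?_
      rintro rfl
      simp at hl
    refine eq_zero_of_sum_Iic_eq μloc hpos ?_ ?_
    · rw [hsmall 0 (by simp), hsmall l (by omega)]
    · intro k hk hk0
      exfalso
      apply hk0
      obtain ⟨hk1, ρ, hρ⟩ := Pi.lt_def.1 hk
      have := Finset.sum_lt_sum (fun i _ => hk1 i) ⟨ρ, Finset.mem_univ ρ, hρ⟩
      have hz : ∑ i, k i = 0 := by omega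
      intro i
      simpa using (Finset.sum_eq_zero_iff.1 hz i (Finset.mem_univ i)).le
  · intro l hl ρ
    by_contra! hρ
    apply hl
    clear hl
    induction l using WellFoundedLT.induction with
    | ind τ ih =>
      have hlt : Function.update τ ρ 2 < τ := by
        rw [update_lt_self_iff]; exact hρ
      refine eq_zero_of_sum_Iic_eq μloc hlt ?_ ?_
      · rw [← hμ, ← hμ]
        congr 1
        refine propext (forall_congr' fun i => exists_congr fun κ => ?_)
        by_cases h : κ = ρ
        · subst h
          have := hle i κ
          simp only [Function.update_self]
          omega
        · simp [Function.update_of_ne h]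
      · intro k hk hk'
        refine ih k hk ?_
        by_contra! h
        exact hk' (le_update_iff.2 ⟨by omega, fun j _ => hk.le j⟩)

/-- A positive integer `n ≤ N` is the product of its prime powers over the primes up to `N`. -/
theorem eq_prod_primesLE_pow {n N : ℕ} (hn : n ≠ 0) (hN : n ≤ N) :
    ∏ p ∈ (Finset.range (N + 1)).filter Nat.Prime, p ^ n.factorization p = n := by
  conv_rhs => rw [← Nat.prod_factorization_pow_eq_self hn]
  symm
  apply Finsupp.prod_of_support_subset
  · intro p hp
    rw [Nat.support_factorization] at hp
    have := Nat.le_of_mem_primeFactors hp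
    simp only [Finset.mem_filter, Finset.mem_range]
    exact ⟨by omega, Nat.prime_of_mem_primeFactors hp⟩
  · simp

/-- For tuples with entries in `[1, N]` the global function is a product over primes up to `N`. -/
theorem muGlob_eq_prod {S : Type*} {μloc : (S → ℕ) → ℤ} (h0 : μloc 0 = 1) {d : S → ℕ} {N : ℕ}
    (hN : ∀ ρ, d ρ ≤ N) :
    muGlob μloc d = ∏ p ∈ (Finset.range (N + 1)).filter Nat.Prime,
      μloc fun ρ => (d ρ).factorization p := by
  unfold muGlob
  refine finprod_mem_eq_prod_of_inter_mulSupport_eq (s := {p | Nat.Prime p}) _ ?_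
  ext p
  simp only [Set.mem_inter_iff, Set.mem_ofPred_eq, Function.mem_mulSupport, Finset.coe_filter,
    Finset.mem_range]
  refine ⟨fun ⟨hp, h⟩ => ⟨⟨?_, hp⟩, h⟩, fun ⟨⟨_, hp⟩, h⟩ => ⟨hp, h⟩⟩
  by_contra hpN
  apply h
  rw [← h0]
  congr 1
  funext ρ
  exact Nat.factorization_eq_zero_of_lt (by have := hN ρ; omega)

/-- The weight `|μ(d)| Π(d)^{-σ}` factors as an Euler product. -/
theorem abs_muGlob_mul_rpow_eq_prod {S : Type*} [Fintype S] {μloc : (S → ℕ) → ℤ}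
    (h0 : μloc 0 = 1) {d : S → ℕ} {N : ℕ}
    (hd : ∀ ρ, d ρ ≠ 0) (hN : ∀ ρ, d ρ ≤ N) (σ : ℝ) :
    |(muGlob μloc d : ℝ)| * ((∏ ρ, d ρ : ℕ) : ℝ) ^ (-σ) =
      ∏ p ∈ (Finset.range (N + 1)).filter Nat.Prime,
        (|(μloc fun ρ => (d ρ).factorization p : ℝ)| *
          ((p : ℝ) ^ (∑ ρ, (d ρ).factorization p)) ^ (-σ)) := by
  rw [Finset.prod_mul_distrib, muGlob_eq_prod h0 hN]
  congr 1
  · push_cast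
    rw [Finset.abs_prod]
  · rw [Real.finsetProd_rpow _ _ (fun _ _ => by positivity)]
    congr 1
    simp only [← Finset.prod_pow_eq_pow_sum]
    rw [Finset.prod_comm]
    push_cast
    refine Finset.prod_congr rfl fun ρ _ => ?_
    exact_mod_cast (eq_prod_primesLE_pow (hd ρ) (hN ρ)).symm

/-- The local Euler factor is at most `exp (K p^{-2σ})`. -/
theorem localFactor_le_exp {S : Type*} [Fintype S] {μloc : (S → ℕ) → ℤ}
    (h0 : μloc 0 = 1) (h1 : ∀ l, ∑ ρ, l ρ = 1 → μloc l = 0) {T : Finset (S → ℕ)}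
    {σ : ℝ} (hσ : 0 ≤ σ) {p : ℕ} (hp : 1 ≤ p) :
    ∑ l ∈ T, |(μloc l : ℝ)| * ((p : ℝ) ^ (∑ ρ, l ρ)) ^ (-σ) ≤
      Real.exp ((∑ l ∈ T, |(μloc l : ℝ)|) * (p : ℝ) ^ (-(2 * σ))) := by
  classical
  have hp' : (1 : ℝ) ≤ p := by exact_mod_cast hp
  refine le_trans ?_ (Real.add_one_le_exp _)
  rw [Finset.sum_mul]
  have hle : ∀ l ∈ T, |(μloc l : ℝ)| * ((p : ℝ) ^ (∑ ρ, l ρ)) ^ (-σ) ≤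
      |(μloc l : ℝ)| * (p : ℝ) ^ (-(2 * σ)) + if l = 0 then 1 else 0 := by
    intro l _
    split_ifs with hl
    · subst hl
      simp only [h0, Pi.zero_apply, Finset.sum_const_zero, pow_zero, Real.one_rpow, Int.cast_one,
        abs_one, mul_one, one_mul]
      have : (0 : ℝ) ≤ (p : ℝ) ^ (-(2 * σ)) := by positivity
      linarith
    · rw [add_zero]
      by_cases hs : ∑ ρ, l ρ = 1
      · simp [h1 l hs]
      · have hs0 : ∑ ρ, l ρ ≠ 0 := fun h => hl <| by
          funext ρ
          exact Finset.sum_eq_zero_iff.1 h ρ (Finset.mem_univ ρ)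
        have h2 : 2 ≤ ∑ ρ, l ρ := by omega
        refine mul_le_mul_of_nonneg_left ?_ (abs_nonneg _)
        rw [← Real.rpow_natCast, ← Real.rpow_mul (by positivity)]
        apply Real.rpow_le_rpow_of_exponent_le hp'
        have : (2 : ℝ) ≤ ((∑ ρ, l ρ : ℕ) : ℝ) := by exact_mod_cast h2
        nlinarith
  refine (Finset.sum_le_sum hle).trans ?_
  rw [Finset.sum_add_distrib]
  gcongr
  rw [Finset.sum_ite_eq']
  split_ifs <;> norm_num

/-- Bound, uniform in `N`, for the partial sums of the Dirichlet series of `|μ|` at `σ > 1/2`. -/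
theorem sum_abs_muGlob_mul_rpow_le {S : Type*} [Fintype S] [DecidableEq S]
    {μloc : (S → ℕ) → ℤ} (h0 : μloc 0 = 1) (h1 : ∀ l, ∑ ρ, l ρ = 1 → μloc l = 0)
    {T : Finset (S → ℕ)} (hT : ∀ l, μloc l ≠ 0 → l ∈ T) {σ : ℝ} (hσ : 1 / 2 < σ) (N : ℕ) :
    ∑ d ∈ Fintype.piFinset fun _ : S => Finset.Icc 1 N,
        |(muGlob μloc d : ℝ)| * ((∏ ρ, d ρ : ℕ) : ℝ) ^ (-σ) ≤
      Real.exp ((∑ l ∈ T, |(μloc l : ℝ)|) * ∑' n : ℕ, (n : ℝ) ^ (-(2 * σ))) := by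
  set P := (Finset.range (N + 1)).filter Nat.Prime with hP
  set A := Fintype.piFinset fun _ : S => Finset.Icc 1 N with hA
  set g : ℕ → (S → ℕ) → ℝ :=
    fun p l => |(μloc l : ℝ)| * ((p : ℝ) ^ (∑ ρ, l ρ)) ^ (-σ) with hg
  have hAmem : ∀ d ∈ A, (∀ ρ, d ρ ≠ 0) ∧ ∀ ρ, d ρ ≤ N := by
    intro d hd
    simp only [hA, Fintype.mem_piFinset, Finset.mem_Icc] at hd
    exact ⟨fun ρ => by have := (hd ρ).1; omega, fun ρ => (hd ρ).2⟩
  have hgnn : ∀ p l, 0 ≤ g p l := fun p l => by positivity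
  let E : (S → ℕ) → P → S → ℕ := fun d p ρ => (d ρ).factorization p
  have hterm : ∀ d ∈ A, |(muGlob μloc d : ℝ)| * ((∏ ρ, d ρ : ℕ) : ℝ) ^ (-σ) =
      ∏ p : P, g p (E d p) := by
    intro d hd
    rw [abs_muGlob_mul_rpow_eq_prod h0 (hAmem d hd).1 (hAmem d hd).2, ← Finset.prod_coe_sort]
  have hinj : Set.InjOn E (A : Set (S → ℕ)) := by
    intro d hd d' hd' h
    funext ρ
    rw [← eq_prod_primesLE_pow ((hAmem d hd).1 ρ) ((hAmem d hd).2 ρ),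
      ← eq_prod_primesLE_pow ((hAmem d' hd').1 ρ) ((hAmem d' hd').2 ρ)]
    refine Finset.prod_congr rfl fun p hp => ?_
    rw [show (d ρ).factorization p = (d' ρ).factorization p from
      congrFun (congrFun h ⟨p, hp⟩) ρ]
  calc _ = ∑ d ∈ A, ∏ p : P, g p (E d p) := Finset.sum_congr rfl hterm
    _ = ∑ x ∈ A.image E, ∏ p : P, g p (x p) :=
        (Finset.sum_image (f := fun x : P → S → ℕ => ∏ p : P, g p (x p)) hinj).symm
    _ ≤ ∑ x ∈ A.image E ∪ Fintype.piFinset (fun _ : P => T), ∏ p : P, g p (x p) :=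
        Finset.sum_le_sum_of_subset_of_nonneg Finset.subset_union_left
          fun x _ _ => Finset.prod_nonneg fun p _ => hgnn _ _
    _ = ∑ x ∈ Fintype.piFinset (fun _ : P => T), ∏ p : P, g p (x p) := by
        symm
        refine Finset.sum_subset Finset.subset_union_right fun x _ hx => ?_
        simp only [Fintype.mem_piFinset, not_forall] at hx
        obtain ⟨p, hp⟩ := hx
        refine Finset.prod_eq_zero (Finset.mem_univ p) ?_
        have : μloc (x p) = 0 := by
          by_contra h
          exact hp (hT _ h)
        simp [hg, this]
    _ = ∏ p : P, ∑ l ∈ T, g p l := (Finset.prod_univ_sum _ _).symm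
    _ = ∏ p ∈ P, ∑ l ∈ T, g p l := Finset.prod_coe_sort P fun p => ∑ l ∈ T, g p l
    _ ≤ ∏ p ∈ P, Real.exp ((∑ l ∈ T, |(μloc l : ℝ)|) * (p : ℝ) ^ (-(2 * σ))) :=
        Finset.prod_le_prod (fun p _ => Finset.sum_nonneg fun l _ => hgnn p l) fun p hp =>
          localFactor_le_exp h0 h1 (by linarith) (Finset.mem_filter.1 hp).2.one_le
    _ = Real.exp ((∑ l ∈ T, |(μloc l : ℝ)|) * ∑ p ∈ P, (p : ℝ) ^ (-(2 * σ))) := by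
        rw [← Real.exp_sum, Finset.mul_sum]
    _ ≤ _ := by
        refine Real.exp_le_exp.2 (mul_le_mul_of_nonneg_left ?_
          (Finset.sum_nonneg fun _ _ => abs_nonneg _))
        exact (Real.summable_nat_rpow.2 (by linarith)).sum_le_tsum _ fun _ _ => by positivity

/-- For every `ε ∈ (0, 1/2)` there is a constant `C > 0` with
`Σ_{Π(d) ≤ Y} |μ(d)| ≤ C · Y^{1/2 + ε}` for all `Y > 1` (a finite sum over positive
tuples `d` with `Π(d) ≤ Y`). -/
theorem stmt13 (S : Type*) [Fintype S] [DecidableEq S] [Nonempty S]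
    (m : ℕ) (Λ : Fin m → S → ℕ)
    (hsum : ∀ i, 2 ≤ ∑ ρ, Λ i ρ) (hle : ∀ i ρ, Λ i ρ ≤ 2)
    (μloc : (S → ℕ) → ℤ)
    (hμ : ∀ τ : S → ℕ,
      (if ∀ i, ∃ ρ, τ ρ < Λ i ρ then (1 : ℤ) else 0) = ∑ l ∈ Finset.Iic τ, μloc l) :
    ∀ ε : ℝ, 0 < ε → ε < 1 / 2 → ∃ C : ℝ, 0 < C ∧ ∀ Y : ℝ, 1 < Y →
      (∑ᶠ (d : S → ℕ) (_ : (∀ ρ, 0 < d ρ) ∧ ((∏ ρ, d ρ : ℕ) : ℝ) ≤ Y),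
          (|muGlob μloc d| : ℝ))
        ≤ C * Y ^ ((1 : ℝ) / 2 + ε) := by
  intro ε hε _
  obtain ⟨h0, h1, h2⟩ := localMoebius_support hsum hle hμ
  have hT : ∀ l, μloc l ≠ 0 → l ∈ Finset.Iic (fun _ : S => 2) :=
    fun l hl => Finset.mem_Iic.2 (h2 l hl)
  refine ⟨Real.exp ((∑ l ∈ Finset.Iic (fun _ : S => 2), |(μloc l : ℝ)|) *
    ∑' n : ℕ, (n : ℝ) ^ (-(2 * (1 / 2 + ε)))), Real.exp_pos _, fun Y hY => ?_⟩
  have hY0 : 0 < Y := by linarith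
  have key := sum_abs_muGlob_mul_rpow_le h0 h1 hT (σ := 1 / 2 + ε) (by linarith) ⌊Y⌋₊
  refine le_trans ?_ (mul_le_mul_of_nonneg_right key (by positivity))
  rw [Finset.sum_mul]
  have hprod : ∀ d : S → ℕ, (∀ ρ, 0 < d ρ) → 0 < ∏ ρ, d ρ :=
    fun d hd => Finset.prod_pos fun ρ _ => hd ρ
  set A := Fintype.piFinset fun _ : S => Finset.Icc 1 ⌊Y⌋₊ with hA
  have hmem : ∀ d : S → ℕ, (∀ ρ, 0 < d ρ) → ((∏ ρ, d ρ : ℕ) : ℝ) ≤ Y → d ∈ A := by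
    intro d hd hdY
    simp only [hA, Fintype.mem_piFinset, Finset.mem_Icc]
    intro ρ
    refine ⟨hd ρ, (Nat.le_of_dvd (hprod d hd) ?_).trans (Nat.le_floor hdY)⟩
    exact Finset.dvd_prod_of_mem d (Finset.mem_univ ρ)
  rw [finsum_eq_sum_of_support_subset (s := A)]
  · refine Finset.sum_le_sum fun d _ => ?_
    by_cases h : (∀ ρ, 0 < d ρ) ∧ ((∏ ρ, d ρ : ℕ) : ℝ) ≤ Y
    · rw [finsum_eq_if, if_pos h, mul_assoc]
      refine le_mul_of_one_le_right (abs_nonneg _) ?_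
      have hpos : (0 : ℝ) < ((∏ ρ, d ρ : ℕ) : ℝ) := by exact_mod_cast hprod d h.1
      rw [Real.rpow_neg hpos.le, inv_mul_eq_div, one_le_div (by positivity)]
      exact Real.rpow_le_rpow hpos.le h.2 (by linarith)
    · rw [finsum_eq_if, if_neg h]
      positivity
  · intro d hd
    by_contra hdA
    apply hd
    dsimp only
    rw [finsum_eq_if, if_neg fun h => hdA (hmem d h.1 h.2)]
end
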